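/- Let L > 0, α > 0, and let g : ℝ → ℝ be an L-periodic continuously differentiable function. Let u : ℝ × ℝ → ℝ, (t, x) ↦ u(t, x), be L-periodic in x, continuously differentiable in t, three times continuously differentiable in x, with ∂_t u, ∂_t∂_x u, ∂_t∂_x²u continuous in (t, x) and with mixed partial derivatives in t and x commuting. Define m := u − α² ∂_x²u and suppose that at every point ∂_t m = −((m + g) ∂_x u + ∂_x((m + g) u)). Then the energy E(t) := ∫₀^L (u(t, x)² + α² (∂_x u(t, x))²) dx is constant in t. -/

import Mathlib

open Set Filter Topology MeasureTheory

/-- The `(b - a)`-multiple of the difference between `f` and its chord over `[a, b]`, at `x`. -/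
noncomputable def chordDefect (f : ℝ → ℝ) (a b x : ℝ) : ℝ :=
  (b - a) * f x - (b - x) * f a - (x - a) * f b

/-- The second antiderivative vanishing to first order at `0`. -/
noncomputable def doublePrimitive (f : ℝ → ℝ) (x : ℝ) : ℝ :=
  ∫ y in (0:ℝ)..x, ∫ s in (0:ℝ)..y, f s

lemma hasDerivAt_primitive {f : ℝ → ℝ} (hf : Continuous f) (x : ℝ) :
    HasDerivAt (fun y => ∫ s in (0:ℝ)..y, f s) (f x) x :=
  intervalIntegral.integral_hasDerivAt_right (hf.intervalIntegrable _ _)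
    hf.stronglyMeasurable.stronglyMeasurableAtFilter hf.continuousAt

lemma continuous_primitive {f : ℝ → ℝ} (hf : Continuous f) :
    Continuous fun y => ∫ s in (0:ℝ)..y, f s :=
  continuous_iff_continuousAt.2 fun x => (hasDerivAt_primitive hf x).continuousAt

lemma hasDerivAt_doublePrimitive {f : ℝ → ℝ} (hf : Continuous f) (x : ℝ) :
    HasDerivAt (doublePrimitive f) (∫ s in (0:ℝ)..x, f s) x :=
  hasDerivAt_primitive (continuous_primitive hf) x

/-- Differentiation under the integral sign for a jointly continuous derivative. -/
lemma hasDerivAt_integral_of_continuous_deriv {f f' : ℝ → ℝ → ℝ}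
    (hf : ∀ t, Continuous (f t)) (hf' : Continuous fun p : ℝ × ℝ => f' p.1 p.2)
    (hd : ∀ t x, HasDerivAt (fun s => f s x) (f' t x) t) (a b t : ℝ) :
    HasDerivAt (fun s => ∫ x in a..b, f s x) (∫ x in a..b, f' t x) t := by
  obtain ⟨C, hC⟩ := ((isCompact_Icc (a := t - 1) (b := t + 1)).prod
    (isCompact_uIcc (a := a) (b := b))).exists_bound_of_continuousOn hf'.continuousOn
  refine (intervalIntegral.hasDerivAt_integral_of_dominated_loc_of_deriv_le
    (bound := fun _ => C) (Icc_mem_nhds (by linarith) (by linarith) : Icc (t - 1) (t + 1) ∈ 𝓝 t)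
    (Eventually.of_forall fun s => (hf s).aestronglyMeasurable)
    ((hf t).intervalIntegrable _ _) ?_ ?_ (by simp) ?_).2
  · exact (hf'.comp (by fun_prop : Continuous fun x : ℝ => (t, x))).aestronglyMeasurable
  · exact Eventually.of_forall fun x hx s hs => hC (s, x) ⟨hs, uIoc_subset_uIcc hx⟩
  · exact Eventually.of_forall fun x _ s _ => hd s x

lemma continuous_primitive_uncurry {f : ℝ → ℝ → ℝ}
    (hf : Continuous fun p : ℝ × ℝ => f p.1 p.2) :
    Continuous fun p : ℝ × ℝ => ∫ s in (0:ℝ)..p.2, f p.1 s := by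
  refine intervalIntegral.continuous_parametric_intervalIntegral_of_continuous
    (f := fun (p : ℝ × ℝ) s => f p.1 s) ?_ continuous_snd
  exact hf.comp (by fun_prop : Continuous fun q : (ℝ × ℝ) × ℝ => (q.1.1, q.2))

lemma continuous_doublePrimitive_uncurry {f : ℝ → ℝ → ℝ}
    (hf : Continuous fun p : ℝ × ℝ => f p.1 p.2) :
    Continuous fun p : ℝ × ℝ => doublePrimitive (f p.1) p.2 :=
  continuous_primitive_uncurry (f := fun t y => ∫ s in (0:ℝ)..y, f t s)
    (continuous_primitive_uncurry hf)

lemma Continuous.slice {f : ℝ → ℝ → ℝ} (hf : Continuous fun p : ℝ × ℝ => f p.1 p.2) (t : ℝ) :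
    Continuous (f t) :=
  hf.comp (by fun_prop : Continuous fun x : ℝ => (t, x))

lemma hasDerivAt_doublePrimitive_param {f f' : ℝ → ℝ → ℝ}
    (hf : ∀ t, Continuous (f t)) (hf' : Continuous fun p : ℝ × ℝ => f' p.1 p.2)
    (hd : ∀ t x, HasDerivAt (fun s => f s x) (f' t x) t) (t x : ℝ) :
    HasDerivAt (fun s => doublePrimitive (f s) x) (doublePrimitive (f' t) x) t :=
  hasDerivAt_integral_of_continuous_deriv (fun t => continuous_primitive (hf t))
    (continuous_primitive_uncurry hf')
    (fun t x => hasDerivAt_integral_of_continuous_deriv hf hf' hd 0 x t) 0 x t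

/-- A function whose second derivative vanishes on an open interval has no chord defect there. -/
lemma chordDefect_eq_zero {f f' : ℝ → ℝ} {S : Set ℝ} (hS : IsOpen S) (hc : Convex ℝ S)
    (h1 : ∀ x ∈ S, HasDerivAt f (f' x) x) (h2 : ∀ x ∈ S, HasDerivAt f' 0 x)
    {a b x : ℝ} (ha : a ∈ S) (hb : b ∈ S) (hx : x ∈ S) : chordDefect f a b x = 0 := by
  obtain ⟨q, hq⟩ := hS.exists_is_const_of_deriv_eq_zero hc.isPreconnected
    (fun x hx => (h2 x hx).differentiableAt.differentiableWithinAt) (fun x hx => (h2 x hx).deriv)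
  have h3 : ∀ x ∈ S, HasDerivAt (fun y => f y - q * y) 0 x := fun x hx => by
    have := (h1 x hx).fun_sub ((hasDerivAt_id x).const_mul q)
    rw [hq x hx] at this
    simpa using this
  obtain ⟨p, hp⟩ := hS.exists_is_const_of_deriv_eq_zero hc.isPreconnected
    (fun x hx => (h3 x hx).differentiableAt.differentiableWithinAt) (fun x hx => (h3 x hx).deriv)
  have e : ∀ x ∈ S, f x = p + q * x := fun x hx => by linarith [hp x hx]
  rw [chordDefect, e a ha, e b hb, e x hx]
  ring

lemma eq_affine_of_chordDefect_eq_zero {f : ℝ → ℝ} {a b : ℝ} (hab : a < b) {x : ℝ}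
    (h : chordDefect f a b x = 0) :
    f x = (b * f a - a * f b) / (b - a) + (f b - f a) / (b - a) * x := by
  have : b - a ≠ 0 := by linarith
  unfold chordDefect at h
  field_simp
  linarith

/-- Second derivatives of functions without chord defect vanish. -/
lemma second_deriv_eq_zero_of_chordDefect {f f' : ℝ → ℝ} {a b c x : ℝ}
    (hx : x ∈ Ioo a b) (h : ∀ y ∈ Ioo a b, chordDefect f a b y = 0)
    (h1 : ∀ y, HasDerivAt f (f' y) y) (h2 : HasDerivAt f' c x) : c = 0 := by
  have hab : a < b := hx.1.trans hx.2
  have e : ∀ y ∈ Ioo a b, f' y = (f b - f a) / (b - a) := fun y hy => by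
    refine (h1 y).unique (HasDerivAt.congr_of_eventuallyEq
      (f := fun y => (b * f a - a * f b) / (b - a) + (f b - f a) / (b - a) * y) ?_ ?_)
    · simpa using ((hasDerivAt_id y).const_mul ((f b - f a) / (b - a))).const_add
        ((b * f a - a * f b) / (b - a))
    · filter_upwards [isOpen_Ioo.mem_nhds hy] with z hz
      exact eq_affine_of_chordDefect_eq_zero hab (h z hz)
  refine h2.unique ((hasDerivAt_const x ((f b - f a) / (b - a))).congr_of_eventuallyEq ?_)
  filter_upwards [isOpen_Ioo.mem_nhds hx] with z hz using e z hz

/-- A function with positive second derivative lies strictly below its chords. -/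
lemma chordDefect_neg {f f' f'' : ℝ → ℝ} {S : Set ℝ} (hc : Convex ℝ S)
    (h1 : ∀ x, HasDerivAt f (f' x) x) (h2 : ∀ x, HasDerivAt f' (f'' x) x)
    (hpos : ∀ x ∈ S, 0 < f'' x) {a b x : ℝ} (ha : a ∈ S) (hb : b ∈ S) (hx : x ∈ Ioo a b) :
    chordDefect f a b x < 0 := by
  have hd : deriv f = f' := funext fun x => (h1 x).deriv
  have hs : StrictConvexOn ℝ S f := by
    refine strictConvexOn_of_deriv2_pos' hc
      (fun x _ => (h1 x).continuousAt.continuousWithinAt) fun x hx => ?_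
    simpa [hd, (h2 x).deriv] using hpos x hx
  have hab : a < b := hx.1.trans hx.2
  have hba : 0 < b - a := by linarith
  have := hs.2 ha hb hab.ne (div_pos (by linarith [hx.2]) hba : 0 < (b - x) / (b - a))
    (div_pos (by linarith [hx.1]) hba : 0 < (x - a) / (b - a)) (by field_simp; ring)
  have e : ((b - x) / (b - a)) • a + ((x - a) / (b - a)) • b = x := by
    simp only [smul_eq_mul]; field_simp; ring
  rw [e] at this
  simp only [smul_eq_mul] at this
  have h3 : (b - a) * f x < (b - a) * ((b - x) / (b - a) * f a + (x - a) / (b - a) * f b) := by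
    gcongr
  have h4 : (b - a) * ((b - x) / (b - a) * f a + (x - a) / (b - a) * f b)
      = (b - x) * f a + (x - a) * f b := by field_simp
  unfold chordDefect
  linarith

/-- If `deriv f` is continuous and `f` vanishes wherever it fails to be differentiable, then `f`
is differentiable. -/
lemma differentiable_of_continuous_deriv_of_zero {f : ℝ → ℝ} (hf : Continuous f)
    (hd : Continuous (deriv f)) (h0 : ∀ x, ¬ DifferentiableAt ℝ f x → f x = 0) :
    Differentiable ℝ f := by
  intro x
  by_contra hx
  have fx := h0 x hx
  have dx := deriv_zero_of_not_differentiableAt hx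
  refine hx (HasDerivAt.differentiableAt (f' := 0) ?_)
  rw [hasDerivAt_iff_isLittleO, Asymptotics.isLittleO_iff]
  intro ε hε
  obtain ⟨δ, hδ, hb⟩ := Metric.continuousAt_iff.1 hd.continuousAt ε hε
  rw [dx] at hb
  filter_upwards [Metric.ball_mem_nhds x hδ] with y hy
  simp only [fx, sub_zero, smul_zero]
  by_cases fy : f y = 0
  · rw [fy, norm_zero]; positivity
  have hclosed : IsClosed {z | f z = 0} := isClosed_eq hf continuous_const
  rw [Metric.mem_ball, Real.dist_eq] at hy
  rcases lt_trichotomy x y with hxy | hxy | hxy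
  · obtain ⟨p, ⟨⟨hp1, hp2⟩, hp0⟩, hpm⟩ := (isCompact_Icc.inter_right hclosed).exists_isGreatest
      (⟨x, ⟨le_refl x, hxy.le⟩, fx⟩ : (Icc x y ∩ {z | f z = 0}).Nonempty)
    have hpy : p < y := lt_of_le_of_ne hp2 fun h => fy (h ▸ hp0)
    obtain ⟨c, hc, hce⟩ := exists_deriv_eq_slope f hpy hf.continuousOn fun z hz => by
      refine (not_not.1 fun hn => ?_ : DifferentiableAt ℝ f z).differentiableWithinAt
      exact absurd (hpm ⟨⟨hp1.trans hz.1.le, hz.2.le⟩, h0 z hn⟩) (not_le.2 hz.1)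
    have hc' : |deriv f c| < ε := by
      simpa using hb (x := c) (by
        rw [Real.dist_eq, abs_lt]
        rw [abs_lt] at hy
        constructor <;> linarith [hc.1, hc.2])
    have : f y = deriv f c * (y - p) := by
      rw [hce, show f p = 0 from hp0, sub_zero, div_mul_cancel₀ _ (by linarith)]
    rw [this, Real.norm_eq_abs, Real.norm_eq_abs, abs_mul, abs_of_pos (by linarith : 0 < y - p),
      abs_of_pos (by linarith : 0 < y - x)]
    gcongr
  · exact absurd (hxy ▸ fx) fy
  · obtain ⟨p, ⟨⟨hp1, hp2⟩, hp0⟩, hpm⟩ := (isCompact_Icc.inter_right hclosed).exists_isLeast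
      (⟨x, ⟨hxy.le, le_refl x⟩, fx⟩ : (Icc y x ∩ {z | f z = 0}).Nonempty)
    have hpy : y < p := lt_of_le_of_ne hp1 fun h => fy (h ▸ hp0)
    obtain ⟨c, hc, hce⟩ := exists_deriv_eq_slope f hpy hf.continuousOn fun z hz => by
      refine (not_not.1 fun hn => ?_ : DifferentiableAt ℝ f z).differentiableWithinAt
      exact absurd (hpm ⟨⟨hz.1.le, hz.2.le.trans hp2⟩, h0 z hn⟩) (not_le.2 hz.2)
    have hc' : |deriv f c| < ε := by
      simpa using hb (x := c) (by
        rw [Real.dist_eq, abs_lt]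
        rw [abs_lt] at hy
        constructor <;> linarith [hc.1, hc.2])
    have : f y = - (deriv f c * (p - y)) := by
      rw [hce, show f p = 0 from hp0, zero_sub, div_mul_cancel₀ _ (by linarith), neg_neg]
    rw [this, Real.norm_eq_abs, Real.norm_eq_abs, abs_neg, abs_mul,
      abs_of_pos (by linarith : 0 < p - y), abs_of_neg (by linarith : y - x < 0)]
    gcongr
    linarith

lemma continuous_timePrimitive {w : ℝ → ℝ → ℝ} (hw : Continuous fun p : ℝ × ℝ => w p.1 p.2) :
    Continuous fun p : ℝ × ℝ => ∫ τ in (0:ℝ)..p.1, w τ p.2 :=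
  (continuous_primitive_uncurry (f := fun x t => w t x) (hw.comp continuous_swap)).comp
    continuous_swap

lemma hasDerivAt_timePrimitive {w : ℝ → ℝ → ℝ} (hw : Continuous fun p : ℝ × ℝ => w p.1 p.2)
    (t x : ℝ) : HasDerivAt (fun s => ∫ τ in (0:ℝ)..s, w τ x) (w t x) t :=
  hasDerivAt_primitive (hw.comp (by fun_prop : Continuous fun τ : ℝ => (τ, x))) t

lemma HasDerivAt.chordDefect {f : ℝ → ℝ → ℝ} {f' : ℝ → ℝ} {t : ℝ}
    (h : ∀ x, HasDerivAt (fun s => f s x) (f' x) t) (a b x : ℝ) :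
    HasDerivAt (fun s => chordDefect (f s) a b x) (chordDefect f' a b x) t :=
  (((h x).const_mul (b - a)).fun_sub ((h a).const_mul (b - x))).fun_sub
    ((h b).const_mul (x - a))

lemma continuous_chordDefect {f : ℝ → ℝ → ℝ} (hf : Continuous fun p : ℝ × ℝ => f p.1 p.2)
    (a b x : ℝ) : Continuous fun s => chordDefect (f s) a b x := by
  have h : ∀ y, Continuous fun s => f s y := fun y =>
    hf.comp (by fun_prop : Continuous fun s : ℝ => (s, y))
  unfold chordDefect
  exact ((continuous_const.mul (h x)).sub (continuous_const.mul (h a))).sub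
    (continuous_const.mul (h b))

lemma chordDefect_sub (f g : ℝ → ℝ) (a b x : ℝ) :
    chordDefect (fun y => f y - g y) a b x = chordDefect f a b x - chordDefect g a b x := by
  simp only [chordDefect]; ring

section TimeDerivative

variable {u v w ux uxx : ℝ → ℝ → ℝ}

lemma hasDerivAt_sub_doublePrimitive_timePrimitive
    (hut : ∀ t x, HasDerivAt (fun s => u s x) (v t x) t)
    (hw : Continuous fun p : ℝ × ℝ => w p.1 p.2) (t x : ℝ) :
    HasDerivAt (fun s => u s x - doublePrimitive (fun y => ∫ τ in (0:ℝ)..s, w τ y) x)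
      (v t x - doublePrimitive (w t) x) t :=
  (hut t x).fun_sub (hasDerivAt_doublePrimitive_param
    (fun t => (continuous_timePrimitive hw).slice (f := fun t y => ∫ τ in (0:ℝ)..t, w τ y) t) hw
    (hasDerivAt_timePrimitive hw) t x)

lemma hasDerivAt_space_first (hux : ∀ t x, HasDerivAt (u t) (ux t x) x)
    (hw : Continuous fun p : ℝ × ℝ => w p.1 p.2) (t x : ℝ) :
    HasDerivAt (fun y => u t y - doublePrimitive (fun y => ∫ τ in (0:ℝ)..t, w τ y) y)
      (ux t x - ∫ s in (0:ℝ)..x, ∫ τ in (0:ℝ)..t, w τ s) x :=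
  (hux t x).fun_sub (hasDerivAt_doublePrimitive
    ((continuous_timePrimitive hw).slice (f := fun t y => ∫ τ in (0:ℝ)..t, w τ y) t) x)

lemma hasDerivAt_space_second (huxx : ∀ t x, HasDerivAt (ux t) (uxx t x) x)
    (hw : Continuous fun p : ℝ × ℝ => w p.1 p.2) (t x : ℝ) :
    HasDerivAt (fun y => ux t y - ∫ s in (0:ℝ)..y, ∫ τ in (0:ℝ)..t, w τ s)
      (uxx t x - ∫ τ in (0:ℝ)..t, w τ x) x :=
  (huxx t x).fun_sub (hasDerivAt_primitive
    ((continuous_timePrimitive hw).slice (f := fun t y => ∫ τ in (0:ℝ)..t, w τ y) t) x)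

/-- If `w` is the time derivative of `u_xx` on a box, then `u_t` has second spatial derivative `w`
there, expressed as the vanishing of chord defects. -/
lemma chordDefect_timeDeriv_eq_zero
    (hut : ∀ t x, HasDerivAt (fun s => u s x) (v t x) t)
    (hw : Continuous fun p : ℝ × ℝ => w p.1 p.2)
    (hux : ∀ t x, HasDerivAt (u t) (ux t x) x) (huxx : ∀ t x, HasDerivAt (ux t) (uxx t x) x)
    {I J : Set ℝ} (hI : IsOpen I) (hIc : Convex ℝ I) (hJ : IsOpen J) (hJc : Convex ℝ J)
    (hd : ∀ t ∈ I, ∀ x ∈ J, HasDerivAt (fun s => uxx s x) (w t x) t)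
    {t a b x : ℝ} (ht : t ∈ I) (ha : a ∈ J) (hb : b ∈ J) (hx : x ∈ J) :
    chordDefect (fun y => v t y - doublePrimitive (w t) y) a b x = 0 := by
  refine (HasDerivAt.chordDefect
    (hasDerivAt_sub_doublePrimitive_timePrimitive hut hw t) a b x).unique
    (HasDerivAt.congr_of_eventuallyEq (hasDerivAt_const t
      (chordDefect (fun y => u t y - doublePrimitive (fun y => ∫ τ in (0:ℝ)..t, w τ y) y) a b x))
      ?_)
  filter_upwards [hI.mem_nhds ht] with s hs
  rw [← sub_eq_zero, ← chordDefect_sub]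
  refine chordDefect_eq_zero hJ hJc (fun y _ => (hasDerivAt_space_first hux hw s y).fun_sub
    (hasDerivAt_space_first hux hw t y)) (fun y hy => ?_) ha hb hx
  have h0 : ∀ r ∈ I, HasDerivAt (fun r => uxx r y - ∫ τ in (0:ℝ)..r, w τ y) 0 r := fun r hr => by
    simpa using (hd r hr y hy).fun_sub (hasDerivAt_timePrimitive hw r y)
  have hconst := hI.is_const_of_deriv_eq_zero hIc.isPreconnected
    (fun r hr => (h0 r hr).differentiableAt.differentiableWithinAt)
    (fun r hr => (h0 r hr).deriv) hs ht
  simpa [hconst] using (hasDerivAt_space_second huxx hw s y).fun_sub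
    (hasDerivAt_space_second huxx hw t y)

/-- Conversely, if `u_t` has second spatial derivative `w` everywhere, then `u_xx` is
differentiable in time with derivative `w`. -/
lemma hasDerivAt_of_chordDefect_timeDeriv
    (hut : ∀ t x, HasDerivAt (fun s => u s x) (v t x) t)
    (hw : Continuous fun p : ℝ × ℝ => w p.1 p.2)
    (hux : ∀ t x, HasDerivAt (u t) (ux t x) x) (huxx : ∀ t x, HasDerivAt (ux t) (uxx t x) x)
    (h : ∀ t a b x, chordDefect (fun y => v t y - doublePrimitive (w t) y) a b x = 0) (t x : ℝ) :
    HasDerivAt (fun s => uxx s x) (w t x) t := by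
  have hconst : ∀ s, uxx s x = uxx t x - (∫ τ in (0:ℝ)..t, w τ x) + ∫ τ in (0:ℝ)..s, w τ x := by
    intro s
    have h0 := second_deriv_eq_zero_of_chordDefect (a := x - 1) (b := x + 1) (x := x)
      ⟨by linarith, by linarith⟩ (fun y _ => ?_)
      (fun y => (hasDerivAt_space_first hux hw s y).fun_sub (hasDerivAt_space_first hux hw t y))
      ((hasDerivAt_space_second huxx hw s x).fun_sub (hasDerivAt_space_second huxx hw t x))
    · linarith
    · rw [chordDefect_sub, sub_eq_zero]
      have hd := fun r => HasDerivAt.chordDefect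
        (hasDerivAt_sub_doublePrimitive_timePrimitive hut hw r) (x - 1) (x + 1) y
      exact is_const_of_deriv_eq_zero (fun r => (hd r).differentiableAt)
        (fun r => by rw [(hd r).deriv]; exact h r _ _ _) s t
  rw [funext hconst]
  exact (hasDerivAt_timePrimitive hw t x).const_add _

/-- A family of solutions of `κ u_xx = u + g - c h(u)`, with `c` depending on time only, which is
differentiable in time as a family of functions has `u_xx` differentiable in time. It suffices
that the equation holds for a dense set of times. -/
lemma differentiableAt_second_deriv_of_steady
    (hu : Continuous fun p : ℝ × ℝ => u p.1 p.2) (hv : Continuous fun p : ℝ × ℝ => v p.1 p.2)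
    (hut : ∀ t x, HasDerivAt (fun s => u s x) (v t x) t)
    (hux : ∀ t x, HasDerivAt (u t) (ux t x) x) (huxx : ∀ t x, HasDerivAt (ux t) (uxx t x) x)
    {g h : ℝ → ℝ} (hg : Continuous g) (hh : ContDiff ℝ 1 h) {κ : ℝ} (hκ : κ ≠ 0)
    {I J T : Set ℝ} (hI : IsOpen I) (hT : I ⊆ closure T) (hJ : IsOpen J) (hJc : Convex ℝ J)
    (hpos : ∀ t ∈ I, ∀ x ∈ J, 0 < h (u t x))
    (hst : ∀ t ∈ T, ∃ c, ∀ x ∈ J, κ * uxx t x = u t x + g x - c * h (u t x))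
    {t x : ℝ} (ht : t ∈ I) (hx : x ∈ J) : DifferentiableAt ℝ (fun s => uxx s x) t := by
  obtain ⟨ε, hε, hball⟩ := Metric.isOpen_iff.1 hJ x hx
  obtain ⟨a, b, ha, hb, hxab, hsub⟩ : ∃ a b, a ∈ J ∧ b ∈ J ∧ x ∈ Ioo a b ∧ Ioo a b ⊆ J := by
    rw [Real.ball_eq_Ioo] at hball
    refine ⟨x - ε / 2, x + ε / 2, hball ⟨by linarith, by linarith⟩,
      hball ⟨by linarith, by linarith⟩, ⟨by linarith, by linarith⟩, fun y hy => hball ?_⟩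
    exact ⟨by linarith [hy.1], by linarith [hy.2]⟩
  have hug : Continuous fun p : ℝ × ℝ => u p.1 p.2 + g p.2 := by fun_prop
  have hhu : Continuous fun p : ℝ × ℝ => h (u p.1 p.2) := hh.continuous.comp hu
  have hdh : Continuous (deriv h) := hh.continuous_deriv le_rfl
  let P : ℝ → ℝ → ℝ := fun t y => κ * u t y - doublePrimitive (fun z => u t z + g z) y
  let Q : ℝ → ℝ → ℝ := fun t y => doublePrimitive (fun z => h (u t z)) y
  have hP : Continuous fun p : ℝ × ℝ => P p.1 p.2 :=
    (continuous_const.mul hu).sub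
      (continuous_doublePrimitive_uncurry (f := fun t z => u t z + g z) hug)
  have hQ : Continuous fun p : ℝ × ℝ => Q p.1 p.2 :=
    continuous_doublePrimitive_uncurry (f := fun t z => h (u t z)) hhu
  have hP1 : ∀ t y, HasDerivAt (P t) (κ * ux t y - ∫ s in (0:ℝ)..y, u t s + g s) y := fun t y =>
    ((hux t y).const_mul κ).fun_sub
      (hasDerivAt_doublePrimitive (hug.slice (f := fun t z => u t z + g z) t) y)
  have hP2 : ∀ t y, HasDerivAt (fun y => κ * ux t y - ∫ s in (0:ℝ)..y, u t s + g s)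
      (κ * uxx t y - (u t y + g y)) y := fun t y =>
    ((huxx t y).const_mul κ).fun_sub
      (hasDerivAt_primitive (hug.slice (f := fun t z => u t z + g z) t) y)
  have hQ1 : ∀ t y, HasDerivAt (Q t) (∫ s in (0:ℝ)..y, h (u t s)) y := fun t y =>
    hasDerivAt_doublePrimitive (hhu.slice (f := fun t z => h (u t z)) t) y
  have hQ2 : ∀ t y, HasDerivAt (fun y => ∫ s in (0:ℝ)..y, h (u t s)) (h (u t y)) y := fun t y =>
    hasDerivAt_primitive (hhu.slice (f := fun t z => h (u t z)) t) y
  have hPt : ∀ t y, HasDerivAt (fun s => P s y) (κ * v t y - doublePrimitive (v t) y) t :=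
    fun t y => ((hut t y).const_mul κ).fun_sub (hasDerivAt_doublePrimitive_param
      (fun t => hug.slice (f := fun t z => u t z + g z) t) hv
      (fun t z => (hut t z).add_const (g z)) t y)
  have hQt : ∀ t y, HasDerivAt (fun s => Q s y)
      (doublePrimitive (fun z => deriv h (u t z) * v t z) y) t :=
    fun t y => hasDerivAt_doublePrimitive_param
      (f' := fun t z => deriv h (u t z) * v t z)
      (fun t => hhu.slice (f := fun t z => h (u t z)) t) ((hdh.comp hu).mul hv)
      (fun t z => ((hh.differentiable one_ne_zero _).hasDerivAt.comp t (hut t z))) t y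
  have hlin : ∀ t c y, chordDefect (fun z => P t z + c * Q t z) a b y
      = chordDefect (P t) a b y + c * chordDefect (Q t) a b y := by
    intro t c y; simp only [chordDefect]; ring
  have hprop : ∀ s ∈ I, ∀ y ∈ Ioo a b, chordDefect (P s) a b y * chordDefect (Q s) a b x
      = chordDefect (P s) a b x * chordDefect (Q s) a b y := by
    intro s hs y hy
    have hcl : IsClosed {s | chordDefect (P s) a b y * chordDefect (Q s) a b x
        = chordDefect (P s) a b x * chordDefect (Q s) a b y} :=
      isClosed_eq ((continuous_chordDefect hP _ _ _).mul (continuous_chordDefect hQ _ _ _))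
        ((continuous_chordDefect hP _ _ _).mul (continuous_chordDefect hQ _ _ _))
    refine hcl.closure_subset_iff.2 (fun r hr => ?_) (hT hs)
    obtain ⟨c, hc⟩ := hst r hr
    have h0 : ∀ y ∈ J, chordDefect (P r) a b y + c * chordDefect (Q r) a b y = 0 := fun y hy => by
      rw [← hlin]
      refine chordDefect_eq_zero hJ hJc (fun z _ => (hP1 r z).fun_add ((hQ1 r z).const_mul c))
        (fun z hz => ?_) ha hb hy
      have := (hP2 r z).fun_add ((hQ2 r z).const_mul c)
      rwa [hc z hz, show u r z + g z - c * h (u r z) - (u r z + g z) + c * h (u r z) = 0 by ring]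
        at this
    have h1 := h0 x hx
    have h2 := h0 y (hsub hy)
    simp only [mem_ofPred_eq]
    linear_combination chordDefect (Q r) a b x * h2 - chordDefect (Q r) a b y * h1
  have hne : ∀ s ∈ I, chordDefect (Q s) a b x ≠ 0 := fun s hs =>
    (chordDefect_neg hJc (hQ1 s) (hQ2 s) (hpos s hs) ha hb hxab).ne
  have hformula : ∀ s ∈ I, uxx s x = (u s x + g x
      + chordDefect (P s) a b x / chordDefect (Q s) a b x * h (u s x)) / κ := by
    intro s hs
    have h0 := second_deriv_eq_zero_of_chordDefect hxab (fun y hy => ?_)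
      (fun y => (hP1 s y).fun_add
        ((hQ1 s y).const_mul (-(chordDefect (P s) a b x / chordDefect (Q s) a b x))))
      ((hP2 s x).fun_add
        ((hQ2 s x).const_mul (-(chordDefect (P s) a b x / chordDefect (Q s) a b x))))
    · rw [eq_div_iff hκ]
      linarith
    · rw [hlin]
      have := hne s hs
      field_simp
      linarith [hprop s hs y hy]
  have hdiff : DifferentiableAt ℝ (fun s => (u s x + g x
      + chordDefect (P s) a b x / chordDefect (Q s) a b x * h (u s x)) / κ) t := by
    have d1 := (HasDerivAt.chordDefect (hPt t) a b x).differentiableAt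
    have d2 := (HasDerivAt.chordDefect (hQt t) a b x).differentiableAt
    have d3 : DifferentiableAt ℝ (fun s => h (u s x)) t :=
      ((hh.differentiable one_ne_zero _).hasDerivAt.comp t (hut t x)).differentiableAt
    exact ((((hut t x).differentiableAt.add_const _).add
      ((d1.div d2 (hne t ht)).mul d3))).div_const κ
  refine hdiff.congr_of_eventuallyEq ?_
  filter_upwards [hI.mem_nhds ht] with s hs using hformula s hs

end TimeDerivative

/-- Near a nonzero point, `s ↦ s⁻²` agrees with a globally `C¹` function. -/
lemma exists_contDiff_eq_inv_sq {r : ℝ} (hr : r ≠ 0) :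
    ∃ h : ℝ → ℝ, ContDiff ℝ 1 h ∧ ∀ᶠ s in 𝓝 r, s ≠ 0 ∧ h s = (s ^ 2)⁻¹ := by
  have hr' : 0 < |r| := abs_pos.2 hr
  let φ : ContDiffBump r := ⟨|r| / 4, |r| / 2, by linarith, by linarith⟩
  refine ⟨fun s => φ s * (s ^ 2)⁻¹, contDiff_iff_contDiffAt.2 fun s => ?_, ?_⟩
  · by_cases hs : s = 0
    · subst hs
      have h0 : (0:ℝ) ∉ tsupport φ := by
        rw [φ.tsupport_eq, Metric.mem_closedBall, Real.dist_eq, zero_sub, abs_neg]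
        change ¬ |r| ≤ |r| / 2
        linarith
      have hz := notMem_tsupport_iff_eventuallyEq.1 h0
      refine (contDiffAt_const (c := (0:ℝ))).congr_of_eventuallyEq ?_
      filter_upwards [hz] with s hs
      simp [hs]
    · exact φ.contDiffAt.mul ((contDiffAt_id.pow 2).inv (pow_ne_zero 2 hs))
  · filter_upwards [φ.eventuallyEq_one, isOpen_ne.mem_nhds hr] with s hs hs0
    exact ⟨hs0, by simp [hs]⟩

lemma exists_ball_box {S : Set (ℝ × ℝ)} {t x : ℝ} (hS : S ∈ 𝓝 (t, x)) :
    ∃ ε > 0, ∀ s ∈ Metric.ball t ε, ∀ y ∈ Metric.ball x ε, (s, y) ∈ S := by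
  obtain ⟨ε, hε, h⟩ := Metric.mem_nhds_iff.1 hS
  exact ⟨ε, hε, fun s hs y hy => h (by rw [← ball_prod_same]; exact ⟨hs, hy⟩)⟩

section Evolution

variable {u v w ux uxx F : ℝ → ℝ → ℝ} {g : ℝ → ℝ} {κ : ℝ}

/-- Where `u_t ≠ 0`, the second spatial derivative of `u_t` is `w`. -/
lemma chordDefect_timeDeriv_eq_zero_of_ne_zero
    (hu : Continuous fun p : ℝ × ℝ => u p.1 p.2) (hv : Continuous fun p : ℝ × ℝ => v p.1 p.2)
    (hw : Continuous fun p : ℝ × ℝ => w p.1 p.2)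
    (hut : ∀ t x, HasDerivAt (fun s => u s x) (v t x) t)
    (hux : ∀ t x, HasDerivAt (u t) (ux t x) x) (huxx : ∀ t x, HasDerivAt (ux t) (uxx t x) x)
    (hwd : ∀ t x, deriv (fun s => uxx s x) t = w t x) (hg : Continuous g) (hκ : κ ≠ 0)
    (hF : ∀ t, Continuous (F t))
    (hFu : ∀ t x, HasDerivAt (fun y => (u t y - κ * uxx t y + g y) * u t y ^ 2)
      (u t x * F t x) x)
    (hbad : ∀ t x, ¬ DifferentiableAt ℝ (fun s => uxx s x) t → F t x = 0)
    (hgood : ∀ t x, DifferentiableAt ℝ (fun s => uxx s x) t → F t x = κ * w t x - v t x)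
    {t₀ x₀ : ℝ} (h0 : v t₀ x₀ ≠ 0) :
    ∃ ε > 0, ∀ a ∈ Metric.ball x₀ ε, ∀ b ∈ Metric.ball x₀ ε, ∀ x ∈ Metric.ball x₀ ε,
      chordDefect (fun y => v t₀ y - doublePrimitive (w t₀) y) a b x = 0 := by
  obtain ⟨ε, hε, hbox⟩ := exists_ball_box
    ((isOpen_ne_fun hv continuous_const).mem_nhds (x := (t₀, x₀)) h0)
  refine ⟨ε, hε, ?_⟩
  set I := Metric.ball t₀ ε with hI
  set J := Metric.ball x₀ ε with hJ
  have hvne : ∀ t ∈ I, ∀ x ∈ J, v t x ≠ 0 := hbox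
  have hx₀ : x₀ ∈ J := Metric.mem_ball_self hε
  have hbad_w : ∀ t x, ¬ DifferentiableAt ℝ (fun s => uxx s x) t → w t x = 0 := fun t x h => by
    rw [← hwd, deriv_zero_of_not_differentiableAt h]
  have dichotomy : ∀ t ∈ I, ∀ x ∈ J, ∀ y ∈ J, ¬ DifferentiableAt ℝ (fun s => uxx s x) t →
      ¬ DifferentiableAt ℝ (fun s => uxx s y) t := by
    intro t ht x hx y hy hnx hdy
    have hvt := hv.slice t
    have hwt := hw.slice t
    obtain ⟨z, hz, ⟨hz1, hz2⟩, hz3⟩ := isPreconnected_closed_iff.1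
      (convex_ball x₀ ε).isPreconnected {x | F t x = 0 ∧ w t x = 0}
      {x | F t x = κ * w t x - v t x}
      ((isClosed_eq (hF t) continuous_const).inter (isClosed_eq hwt continuous_const))
      (isClosed_eq (hF t) ((continuous_const.mul hwt).sub hvt))
      (fun z _ => (em (DifferentiableAt ℝ (fun s => uxx s z) t)).symm.imp
        (fun h => ⟨hbad t z h, hbad_w t z h⟩) (hgood t z))
      ⟨x, hx, hbad t x hnx, hbad_w t x hnx⟩ ⟨y, hy, hgood t y hdy⟩
    refine hvne t ht z hz ?_
    have hz3' : F t z = κ * w t z - v t z := hz3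
    rw [hz1, hz2] at hz3'
    linarith
  set T := {t | t ∈ I ∧ ¬ DifferentiableAt ℝ (fun s => uxx s x₀) t} with hTdef
  have hdense : ∀ t ∈ I, t ∈ closure (I \ closure T) := by
    intro t₁ ht₁
    by_contra hcl
    obtain ⟨δ, hδ, hsub⟩ := Metric.isOpen_iff.1
      (isClosed_closure.isOpen_compl.inter (Metric.isOpen_ball (x := t₀) (ε := ε))) t₁ ⟨hcl, ht₁⟩
    have hsubT : Metric.ball t₁ δ ⊆ closure T := fun s hs => by
      by_contra hn
      exact (hsub hs).1 (subset_closure ⟨(hsub hs).2, hn⟩)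
    obtain ⟨t₂, ht₂, hne⟩ : ∃ t₂ ∈ Metric.ball t₁ δ, u t₂ x₀ ≠ 0 := by
      by_contra! hz
      refine hvne t₁ ht₁ x₀ hx₀ ((hut t₁ x₀).unique
        ((hasDerivAt_const t₁ (0:ℝ)).congr_of_eventuallyEq ?_))
      filter_upwards [Metric.ball_mem_nhds t₁ hδ] with s hs using hz s hs
    obtain ⟨h, hh, heq⟩ := exists_contDiff_eq_inv_sq hne
    obtain ⟨η, hη, hbox'⟩ := exists_ball_box ((hu.continuousAt.eventually heq).and
      (((Metric.isOpen_ball.prod Metric.isOpen_ball).mem_nhds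
        (⟨ht₂, hx₀⟩ : (t₂, x₀) ∈ Metric.ball t₁ δ ×ˢ J))))
    have ht₂η : t₂ ∈ Metric.ball t₂ η := Metric.mem_ball_self hη
    have hx₀η : x₀ ∈ Metric.ball x₀ η := Metric.mem_ball_self hη
    have hclT : Metric.ball t₂ η ⊆ closure (Metric.ball t₂ η ∩ T) := fun s hs =>
      Metric.isOpen_ball.inter_closure ⟨hs, hsubT (hbox' s hs x₀ hx₀η).2.1⟩
    have hdiff : ∀ s ∈ Metric.ball t₂ η, DifferentiableAt ℝ (fun s => uxx s x₀) s := by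
      intro s hs
      refine differentiableAt_second_deriv_of_steady hu hv hut hux huxx hg hh hκ
        Metric.isOpen_ball hclT Metric.isOpen_ball (convex_ball x₀ η) (fun t ht x hx => ?_)
        (fun t ht => ?_) hs hx₀η
      · obtain ⟨⟨hn, he⟩, -⟩ := hbox' t ht x hx
        rw [he]
        positivity
      · have hz : ∀ x ∈ Metric.ball x₀ η,
            HasDerivAt (fun y => (u t y - κ * uxx t y + g y) * u t y ^ 2) 0 x := fun x hx => by
          have := hFu t x
          rwa [hbad t x (dichotomy t ht.2.1 x₀ hx₀ x (hbox' t ht.1 x hx).2.2 ht.2.2), mul_zero]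
            at this
        obtain ⟨c, hc⟩ := Metric.isOpen_ball.exists_is_const_of_deriv_eq_zero
          (convex_ball x₀ η).isPreconnected
          (fun x hx => (hz x hx).differentiableAt.differentiableWithinAt)
          (fun x hx => (hz x hx).deriv)
        refine ⟨c, fun x hx => ?_⟩
        obtain ⟨⟨hn, he⟩, -⟩ := hbox' t ht.1 x hx
        rw [he, ← hc x hx, mul_inv_cancel_right₀ (pow_ne_zero 2 hn)]
        ring
    obtain ⟨s, hs⟩ := closure_nonempty_iff.1 ⟨t₂, hclT ht₂η⟩
    exact hs.2.2 (hdiff s hs.1)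
  intro a ha b hb x hx
  have hz : Continuous fun p : ℝ × ℝ => v p.1 p.2 - doublePrimitive (w p.1) p.2 :=
    hv.sub (continuous_doublePrimitive_uncurry hw)
  have hcl : IsClosed {t | chordDefect (fun y => v t y - doublePrimitive (w t) y) a b x = 0} :=
    isClosed_eq (continuous_chordDefect (f := fun t y => v t y - doublePrimitive (w t) y)
      hz a b x) continuous_const
  refine hcl.closure_subset_iff.2 (fun t ht => ?_) (hdense t₀ (Metric.mem_ball_self hε))
  obtain ⟨δ, hδ, hsub⟩ := Metric.isOpen_iff.1
    (Metric.isOpen_ball.inter isClosed_closure.isOpen_compl) t ht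
  refine chordDefect_timeDeriv_eq_zero hut hw hux huxx Metric.isOpen_ball (convex_ball t δ)
    Metric.isOpen_ball (convex_ball x₀ ε) (fun s hs y hy => ?_) (Metric.mem_ball_self hδ) ha hb hx
  have hd : DifferentiableAt ℝ (fun s => uxx s y) s := by
    by_contra hn
    exact (hsub hs).2 (subset_closure ⟨(hsub hs).1, dichotomy s (hsub hs).1 y hy x₀ hx₀ hn⟩)
  exact hwd s y ▸ hd.hasDerivAt

end Evolution

lemma differentiable_twice_of_chordDefect {f w : ℝ → ℝ} (hw : Continuous w) {x ε : ℝ} (hε : 0 < ε)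
    (h : ∀ a ∈ Metric.ball x ε, ∀ b ∈ Metric.ball x ε, ∀ y ∈ Metric.ball x ε,
      chordDefect (fun y => f y - doublePrimitive w y) a b y = 0) :
    (∀ᶠ y in 𝓝 x, DifferentiableAt ℝ f y) ∧ DifferentiableAt ℝ (deriv f) x := by
  obtain ⟨p, q, hpq⟩ : ∃ p q : ℝ, ∀ y ∈ Metric.ball x ε, f y = p + q * y + doublePrimitive w y := by
    have hx : x ∈ Metric.ball x ε := Metric.mem_ball_self hε
    have hb : x + ε / 2 ∈ Metric.ball x ε := by
      rw [Real.ball_eq_Ioo]; constructor <;> linarith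
    exact ⟨_, _, fun y hy => sub_eq_iff_eq_add.1
      (eq_affine_of_chordDefect_eq_zero (by linarith) (h x hx _ hb y hy))⟩
  have hd : ∀ y ∈ Metric.ball x ε, HasDerivAt f (q + ∫ s in (0:ℝ)..y, w s) y := fun y hy => by
    refine HasDerivAt.congr_of_eventuallyEq (f := fun y => p + q * y + doublePrimitive w y) ?_ ?_
    · simpa using (((hasDerivAt_id y).const_mul q).const_add p).fun_add
        (hasDerivAt_doublePrimitive hw y)
    · filter_upwards [Metric.isOpen_ball.mem_nhds hy] with z hz using hpq z hz
  constructor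
  · filter_upwards [Metric.ball_mem_nhds x hε] with y hy using (hd y hy).differentiableAt
  · refine ((hasDerivAt_primitive hw x).const_add q).differentiableAt.congr_of_eventuallyEq ?_
    filter_upwards [Metric.ball_mem_nhds x hε] with y hy using (hd y hy).deriv

/-- If `f` is twice differentiable wherever it does not vanish and `deriv f`, `deriv (deriv f)`
are continuous, then `f` is twice differentiable. -/
lemma differentiable_twice_of_ne_zero {f : ℝ → ℝ} (hf : Continuous f)
    (hd : Continuous (deriv f)) (hdd : Continuous (deriv (deriv f)))
    (h : ∀ x, f x ≠ 0 →
      (∀ᶠ y in 𝓝 x, DifferentiableAt ℝ f y) ∧ DifferentiableAt ℝ (deriv f) x) :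
    Differentiable ℝ f ∧ Differentiable ℝ (deriv f) := by
  have h1 : Differentiable ℝ f := differentiable_of_continuous_deriv_of_zero hf hd fun x hx => by
    by_contra hn
    exact hx (h x hn).1.self_of_nhds
  refine ⟨h1, differentiable_of_continuous_deriv_of_zero hd hdd fun x hx => ?_⟩
  by_contra hn
  have hne : {y | DifferentiableAt ℝ (deriv f) y} ∈ 𝓝[≠] x := by
    filter_upwards [(h1 x).hasDerivAt.eventually_ne (c := 0) hn] with y hy using (h y hy).2
  have hdiff : DifferentiableOn ℝ (deriv f) {y | DifferentiableAt ℝ (deriv f) y} :=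
    fun y hy => DifferentiableAt.differentiableWithinAt hy
  have hr := hasDerivWithinAt_Ici_of_tendsto_deriv hdiff hd.continuousWithinAt
    (nhdsGT_le_nhdsNE x hne) hdd.continuousAt.continuousWithinAt
  have hl := hasDerivWithinAt_Iic_of_tendsto_deriv hdiff hd.continuousWithinAt
    (nhdsLT_le_nhdsNE x hne) hdd.continuousAt.continuousWithinAt
  have := hl.union hr
  rw [Iic_union_Ici, hasDerivWithinAt_univ] at this
  exact hx this.differentiableAt

/-- A function with jointly continuous time derivative and continuous initial datum is jointly
continuous. -/
lemma continuous_of_hasDerivAt_time {u v : ℝ → ℝ → ℝ} (hu : Continuous (u 0))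
    (hv : Continuous fun p : ℝ × ℝ => v p.1 p.2)
    (hut : ∀ t x, HasDerivAt (fun s => u s x) (v t x) t) :
    Continuous fun p : ℝ × ℝ => u p.1 p.2 := by
  have e : ∀ t x, u t x = u 0 x + ∫ τ in (0:ℝ)..t, v τ x := fun t x => by
    rw [intervalIntegral.integral_eq_sub_of_hasDerivAt (fun s _ => hut s x)
      ((hv.comp (by fun_prop : Continuous fun τ : ℝ => (τ, x))).intervalIntegrable _ _)]
    ring
  rw [funext fun p : ℝ × ℝ => e p.1 p.2]
  exact (hu.comp continuous_snd).add (continuous_timePrimitive hv)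

lemma Function.Periodic.deriv {f : ℝ → ℝ} {c : ℝ} (hf : Function.Periodic f c) :
    Function.Periodic (deriv f) c := fun x => by
  rw [← deriv_comp_add_const, funext hf]

/-- Integration by parts over a period. -/
lemma integral_mul_eq_neg_of_periodic {f f' h h' : ℝ → ℝ} {L : ℝ}
    (hf : ∀ x, HasDerivAt f (f' x) x) (hh : ∀ x, HasDerivAt h (h' x) x)
    (hf' : Continuous f') (hh' : Continuous h') (pf : f L = f 0) (ph : h L = h 0) :
    ∫ x in (0:ℝ)..L, f x * h' x = -∫ x in (0:ℝ)..L, f' x * h x := by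
  rw [intervalIntegral.integral_mul_deriv_eq_deriv_mul (fun x _ => hf x) (fun x _ => hh x)
    (hf'.intervalIntegrable _ _) (hh'.intervalIntegrable _ _), pf, ph, sub_self, zero_sub]

/-- Deterministic core of Proposition 2.1 (energy preservation by the SFLT
stochastic Camassa–Holm flow): with the momentum perturbed by a fixed
`L`-periodic spatial amplitude `g`,
`m_t = −((m + g) u_x + ((m + g) u)_x)`, `m = u − α²∂_x²u`,
the energy is conserved. -/
theorem sflt_camassa_holm_energy_conservation
    (L α : ℝ) (hL : 0 < L) (hα : 0 < α)
    (g : ℝ → ℝ) (hg : ContDiff ℝ 1 g) (pg : Function.Periodic g L)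
    (u : ℝ → ℝ → ℝ)
    (hper : ∀ t, Function.Periodic (u t) L)
    (hx : ∀ t, ContDiff ℝ 3 (u t))
    (ht : ∀ x, ContDiff ℝ 1 fun t => u t x)
    (hcont_t : Continuous fun p : ℝ × ℝ => deriv (fun s => u s p.2) p.1)
    (hcont_tx : Continuous fun p : ℝ × ℝ => deriv (fun s => deriv (u s) p.2) p.1)
    (hcont_txx : Continuous fun p : ℝ × ℝ => deriv (fun s => deriv (deriv (u s)) p.2) p.1)
    (hmix1 : ∀ t x, deriv (fun s => deriv (u s) x) t
      = deriv (fun y => deriv (fun s => u s y) t) x)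
    (hmix2 : ∀ t x, deriv (fun s => deriv (deriv (u s)) x) t
      = deriv (deriv fun y => deriv (fun s => u s y) t) x)
    (m : ℝ → ℝ → ℝ)
    (hm : ∀ t x, m t x = u t x - α ^ 2 * deriv (deriv (u t)) x)
    (hpde : ∀ t x, deriv (fun s => m s x) t
      = -((m t x + g x) * deriv (u t) x + deriv (fun y => (m t y + g y) * u t y) x)) :
    ∀ t₁ t₂ : ℝ,
      (∫ x in (0:ℝ)..L, ((u t₁ x) ^ 2 + α ^ 2 * (deriv (u t₁) x) ^ 2)) =
        ∫ x in (0:ℝ)..L, ((u t₂ x) ^ 2 + α ^ 2 * (deriv (u t₂) x) ^ 2) := by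
  set κ : ℝ := α ^ 2 with hκ_def
  have hκ : κ ≠ 0 := by positivity
  let v : ℝ → ℝ → ℝ := fun t x => deriv (fun s => u s x) t
  let w : ℝ → ℝ → ℝ := fun t x => deriv (fun s => deriv (deriv (u s)) x) t
  have hv : Continuous fun p : ℝ × ℝ => v p.1 p.2 := hcont_t
  have hw : Continuous fun p : ℝ × ℝ => w p.1 p.2 := hcont_txx
  have hut : ∀ t x, HasDerivAt (fun s => u s x) (v t x) t := fun t x =>
    ((ht x).differentiable one_ne_zero t).hasDerivAt
  have hx1 : ∀ t, ContDiff ℝ 2 (deriv (u t)) := fun t =>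
    ((contDiff_succ_iff_deriv (n := 2)).1 (hx t)).2.2
  have hx2 : ∀ t, ContDiff ℝ 1 (deriv (deriv (u t))) := fun t =>
    ((contDiff_succ_iff_deriv (n := 1)).1 (hx1 t)).2.2
  have hux : ∀ t x, HasDerivAt (u t) (deriv (u t) x) x := fun t x =>
    ((hx t).differentiable three_ne_zero x).hasDerivAt
  have huxx : ∀ t x, HasDerivAt (deriv (u t)) (deriv (deriv (u t)) x) x := fun t x =>
    ((hx1 t).differentiable two_ne_zero x).hasDerivAt
  have huxxx : ∀ t x, HasDerivAt (deriv (deriv (u t))) (deriv (deriv (deriv (u t))) x) x :=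
    fun t x => ((hx2 t).differentiable one_ne_zero x).hasDerivAt
  have hgd : ∀ x, HasDerivAt g (deriv g x) x := fun x => (hg.differentiable one_ne_zero x).hasDerivAt
  have hgdc : Continuous (deriv g) := hg.continuous_deriv le_rfl
  have hu3c : ∀ t, Continuous (deriv (deriv (deriv (u t)))) := fun t =>
    (hx2 t).continuous_deriv le_rfl
  have hu2c : ∀ t, Continuous (deriv (deriv (u t))) := fun t => (hx2 t).continuous
  have hu1c : ∀ t, Continuous (deriv (u t)) := fun t => (hx1 t).continuous
  have hu0c : ∀ t, Continuous (u t) := fun t => (hx t).continuous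
  have hu : Continuous fun p : ℝ × ℝ => u p.1 p.2 :=
    continuous_of_hasDerivAt_time (hu0c 0) hv hut
  have hmx : ∀ t x, HasDerivAt (m t) (deriv (u t) x - κ * deriv (deriv (deriv (u t))) x) x :=
    fun t x => by
      rw [funext (hm t)]
      exact (hux t x).fun_sub ((huxxx t x).const_mul κ)
  let F : ℝ → ℝ → ℝ := fun t x => 2 * (m t x + g x) * deriv (u t) x
    + (deriv (u t) x - κ * deriv (deriv (deriv (u t))) x + deriv g x) * u t x
  have hpde' : ∀ t x, deriv (fun s => m s x) t = -F t x := fun t x => by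
    rw [hpde t x, (((hmx t x).fun_add (hgd x)).fun_mul (hux t x)).deriv]
    ring
  have hmc : ∀ t, Continuous (m t) := fun t =>
    continuous_iff_continuousAt.2 fun x => (hmx t x).continuousAt
  have hF : ∀ t, Continuous (F t) := fun t =>
    ((continuous_const.mul ((hmc t).add hg.continuous)).mul (hu1c t)).add
      ((((hu1c t).sub (continuous_const.mul (hu3c t))).add hgdc).mul (hu0c t))
  have hFu : ∀ t x, HasDerivAt (fun y => (m t y + g y) * u t y ^ 2) (u t x * F t x) x :=
    fun t x => by
      refine (((hmx t x).fun_add (hgd x)).fun_mul ((hux t x).fun_pow 2)).congr_deriv ?_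
      simp only [F]
      ring
  have hmt : ∀ t x, DifferentiableAt ℝ (fun s => deriv (deriv (u s)) x) t →
      HasDerivAt (fun s => m s x) (v t x - κ * w t x) t := fun t x hd => by
    rw [funext fun s => hm s x]
    exact (hut t x).fun_sub (hd.hasDerivAt.const_mul κ)
  have hgood : ∀ t x, DifferentiableAt ℝ (fun s => deriv (deriv (u s)) x) t →
      F t x = κ * w t x - v t x := fun t x hd => by
    have := hpde' t x
    rw [(hmt t x hd).deriv] at this
    linarith
  have hbad : ∀ t x, ¬ DifferentiableAt ℝ (fun s => deriv (deriv (u s)) x) t → F t x = 0 :=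
    fun t x hn => by
      have h0 : ¬ DifferentiableAt ℝ (fun s => m s x) t := fun hd => by
        refine hn ((((hut t x).differentiableAt.fun_sub hd).const_mul κ⁻¹).congr_of_eventuallyEq
          (Eventually.of_forall fun s => ?_))
        simp only [hm]
        field_simp
        ring
      have := hpde' t x
      rw [deriv_zero_of_not_differentiableAt h0] at this
      linarith
  have hv1 : ∀ t, deriv (v t) = fun x => deriv (fun s => deriv (u s) x) t := fun t =>
    funext fun x => (hmix1 t x).symm
  have hv2 : ∀ t, deriv (deriv (v t)) = w t := fun t => funext fun x => (hmix2 t x).symm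
  have hv1c : ∀ t, Continuous (deriv (v t)) := fun t => by
    rw [hv1]
    exact hcont_tx.comp (by fun_prop : Continuous fun x : ℝ => (t, x))
  have hvdiff : ∀ t, Differentiable ℝ (v t) ∧ Differentiable ℝ (deriv (v t)) := fun t =>
    differentiable_twice_of_ne_zero (hv.slice t) (hv1c t) (hv2 t ▸ hw.slice t) fun x hne => by
      obtain ⟨ε, hε, h⟩ := chordDefect_timeDeriv_eq_zero_of_ne_zero hu hv hw hut hux huxx
        (fun _ _ => rfl) hg.continuous hκ hF
        (fun t x => by simpa only [hm] using hFu t x) hbad hgood hne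
      exact differentiable_twice_of_chordDefect (hw.slice t) hε h
  have hvx : ∀ t x, HasDerivAt (v t) (deriv (v t) x) x := fun t x => ((hvdiff t).1 x).hasDerivAt
  have hvxx : ∀ t x, HasDerivAt (deriv (v t)) (w t x) x := fun t x => by
    rw [← hv2]
    exact ((hvdiff t).2 x).hasDerivAt
  have huxxt : ∀ t x, HasDerivAt (fun s => deriv (deriv (u s)) x) (w t x) t :=
    hasDerivAt_of_chordDefect_timeDeriv hut hw hux huxx fun t a b x =>
      chordDefect_eq_zero isOpen_univ convex_univ
        (fun y _ => (hvx t y).fun_sub (hasDerivAt_doublePrimitive (hw.slice t) y))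
        (fun y _ => by
          simpa using (hvxx t y).fun_sub (hasDerivAt_primitive (hw.slice t) y))
        (mem_univ a) (mem_univ b) (mem_univ x)
  have huxxc : Continuous fun p : ℝ × ℝ => deriv (deriv (u p.1)) p.2 :=
    continuous_of_hasDerivAt_time (u := fun t => deriv (deriv (u t))) (hu2c 0) hw huxxt
  have hmjc : Continuous fun p : ℝ × ℝ => m p.1 p.2 := by
    simp only [hm]
    exact hu.sub (continuous_const.mul huxxc)
  have hmt' := fun t x => hmt t x (huxxt t x).differentiableAt
  have hper1 : ∀ t, deriv (u t) L = deriv (u t) 0 := fun t => by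
    simpa using ((hper t).deriv 0)
  have hper0 : ∀ t, u t L = u t 0 := fun t => by simpa using hper t 0
  have hperv : ∀ t, Function.Periodic (v t) L := fun t x => by
    simp only [v, fun s => hper s x]
  have hperv0 : ∀ t, v t L = v t 0 := fun t => by simpa using hperv t 0
  have hperv1 : ∀ t, deriv (v t) L = deriv (v t) 0 := fun t => by
    simpa using ((hperv t).deriv 0)
  have energy_eq : ∀ t, (∫ x in (0:ℝ)..L, ((u t x) ^ 2 + κ * (deriv (u t) x) ^ 2))
      = ∫ x in (0:ℝ)..L, u t x * m t x := fun t => by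
    have hp := integral_mul_eq_neg_of_periodic (hux t) (huxx t) (hu1c t) (hu2c t) (hper0 t)
      (hper1 t)
    have h0 := hu0c t
    have h1 := hu1c t
    have h2 := hu2c t
    have e : ∀ x, u t x * m t x = u t x ^ 2 - κ * (u t x * deriv (deriv (u t)) x) := fun x => by
      rw [hm]; ring
    simp only [e]
    rw [intervalIntegral.integral_add, intervalIntegral.integral_sub,
      intervalIntegral.integral_const_mul, intervalIntegral.integral_const_mul, hp]
    · simp only [pow_two]; ring
    all_goals exact Continuous.intervalIntegrable (by fun_prop) _ _
  have pairing : ∀ t, ∫ x in (0:ℝ)..L, v t x * m t x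
      = ∫ x in (0:ℝ)..L, u t x * (v t x - κ * w t x) := fun t => by
    have p1 := integral_mul_eq_neg_of_periodic (hvx t) (huxx t) (hv1c t) (hu2c t) (hperv0 t)
      (hper1 t)
    have p2 := integral_mul_eq_neg_of_periodic (hux t) (hvxx t) (hu1c t) (hw.slice t) (hper0 t)
      (hperv1 t)
    have h0 := hu0c t
    have h2 := hu2c t
    have hv0 := hv.slice t
    have hw0 := hw.slice t
    have e1 : ∀ x, v t x * m t x = u t x * v t x - κ * (v t x * deriv (deriv (u t)) x) :=
      fun x => by rw [hm]; ring
    have e2 : ∀ x, u t x * (v t x - κ * w t x) = u t x * v t x - κ * (u t x * w t x) :=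
      fun x => by ring
    simp only [e1, e2]
    rw [intervalIntegral.integral_sub, intervalIntegral.integral_sub,
      intervalIntegral.integral_const_mul, intervalIntegral.integral_const_mul, p1, p2]
    · simp only [mul_comm]
    all_goals exact Continuous.intervalIntegrable (by fun_prop) _ _
  have transport : ∀ t, ∫ x in (0:ℝ)..L, u t x * (v t x - κ * w t x) = 0 := fun t => by
    have e : ∀ x, u t x * (v t x - κ * w t x) = -(u t x * F t x) := fun x => by
      rw [hgood t x (huxxt t x).differentiableAt]; ring
    have hper2 : deriv (deriv (u t)) L = deriv (deriv (u t)) 0 := by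
      simpa using ((hper t).deriv.deriv 0)
    simp only [e]
    rw [intervalIntegral.integral_neg, intervalIntegral.integral_eq_sub_of_hasDerivAt
      (fun x _ => hFu t x) (((hu0c t).mul (hF t)).intervalIntegrable _ _), hm, hm, hper2, hper0,
      show g L = g 0 by simpa using pg 0, sub_self, neg_zero]
  have hE : ∀ t, HasDerivAt (fun t => ∫ x in (0:ℝ)..L, u t x * m t x) 0 t := fun t => by
    convert hasDerivAt_integral_of_continuous_deriv
      (f := fun t x => u t x * m t x)
      (f' := fun t x => v t x * m t x + u t x * (v t x - κ * w t x))
      (fun t => (hu0c t).mul (hmc t))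
      ((hv.mul hmjc).add (hu.mul (hv.sub (continuous_const.mul hw))))
      (fun t x => (hut t x).fun_mul (hmt' t x)) 0 L t using 1
    have hv0 := hv.slice t
    have hw0 := hw.slice t
    have h0 := hu0c t
    have hm0 := hmc t
    rw [intervalIntegral.integral_add, pairing, transport, add_zero]
    all_goals exact Continuous.intervalIntegrable (by fun_prop) _ _
  intro t₁ t₂
  rw [energy_eq, energy_eq]
  exact is_const_of_deriv_eq_zero (fun t => (hE t).differentiableAt) (fun t => (hE t).deriv) t₁ t₂
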